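/- For every μ ∈ (0, 1), 2 l_μ'(1) = μ(μ+1) ∫₀¹ (1 − t)^{μ−1} (cos t + (1 − μ) sin t) dt, and consequently l_μ'(1) > 0. -/

import Mathlib

noncomputable section

/-- The normalized Lommel function of the first kind (real restriction),
`l_μ(x) = ∑ (−1)^n Γ(μ/2+1) Γ(μ/2+3/2) x^(n+1) / (4^n Γ(μ/2+n+1) Γ(μ/2+n+3/2))`. -/
def lommelLR (μ : ℝ) (x : ℝ) : ℝ :=
  ∑' n : ℕ, ((-1 : ℝ) ^ n * Real.Gamma (μ / 2 + 1) * Real.Gamma (μ / 2 + 3 / 2) * x ^ (n + 1)) /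
    (4 ^ n * Real.Gamma (μ / 2 + n + 1) * Real.Gamma (μ / 2 + n + 3 / 2))

open MeasureTheory intervalIntegral

/-- The weight `(1 - t) ^ (μ - 1)` is integrable on `[0, 1]` for `μ > 0`. -/
theorem intervalIntegrable_one_sub_rpow {μ : ℝ} (hμ : 0 < μ) :
    IntervalIntegrable (fun t : ℝ => (1 - t) ^ (μ - 1)) volume 0 1 := by
  have h := (intervalIntegrable_rpow' (a := 0) (b := 1) (r := μ - 1) (by linarith)).comp_sub_left 1
  simpa using h.symm

/-- Beta integral with one natural-number exponent. -/
theorem integral_one_sub_rpow_mul_pow {μ : ℝ} (hμ : 0 < μ) (k : ℕ) :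
    ∫ t in (0 : ℝ)..1, (1 - t) ^ (μ - 1) * t ^ k =
      Real.Gamma μ * (k.factorial : ℝ) / Real.Gamma (μ + k + 1) := by
  have h := Complex.betaIntegral_eq_Gamma_mul_div ((k + 1 : ℝ) : ℂ) (μ : ℂ)
    (by rw [Complex.ofReal_re]; positivity) (by simpa using hμ)
  have hb : Complex.betaIntegral ((k + 1 : ℝ) : ℂ) (μ : ℂ) =
      ((∫ t in (0 : ℝ)..1, (1 - t) ^ (μ - 1) * t ^ k : ℝ) : ℂ) := by
    rw [Complex.betaIntegral, ← integral_ofReal]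
    refine integral_congr fun t ht => ?_
    rw [Set.uIcc_of_le zero_le_one] at ht
    have h1 : (0 : ℝ) ≤ 1 - t := by linarith [ht.2]
    push_cast [Complex.ofReal_cpow h1]
    rw [add_sub_cancel_right, Complex.cpow_natCast, mul_comm]
  rw [hb, ← Complex.ofReal_add, Complex.Gamma_ofReal, Complex.Gamma_ofReal,
    Complex.Gamma_ofReal] at h
  have h' : (∫ t in (0 : ℝ)..1, (1 - t) ^ (μ - 1) * t ^ k) =
      Real.Gamma (k + 1) * Real.Gamma μ / Real.Gamma (k + 1 + μ) := by exact_mod_cast h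
  rw [h', Real.Gamma_nat_eq_factorial, mul_comm, show (k : ℝ) + 1 + μ = μ + k + 1 by ring]

/-- Termwise integration of an absolutely convergent power series against `(1 - t) ^ (μ - 1)`. -/
theorem hasSum_integral_one_sub_rpow_mul {μ : ℝ} (hμ : 0 < μ) {c : ℕ → ℝ} {e : ℕ → ℕ}
    {f : ℝ → ℝ} (hc : Summable fun n => |c n|)
    (hf : ∀ t, HasSum (fun n => c n * t ^ e n) (f t)) :
    HasSum (fun n => c n * (Real.Gamma μ * ((e n).factorial : ℝ) / Real.Gamma (μ + e n + 1)))
      (∫ t in (0 : ℝ)..1, (1 - t) ^ (μ - 1) * f t) := by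
  have key : HasSum (fun n => ∫ t in (0 : ℝ)..1, (1 - t) ^ (μ - 1) * (c n * t ^ e n))
      (∫ t in (0 : ℝ)..1, (1 - t) ^ (μ - 1) * f t) := by
    refine intervalIntegral.hasSum_integral_of_dominated_convergence
      (fun n t => (1 - t) ^ (μ - 1) * |c n|) (fun n => ?_) (fun n => ?_) ?_ ?_ ?_
    · exact Measurable.aestronglyMeasurable (by fun_prop)
    · refine Filter.Eventually.of_forall fun t ht => ?_
      rw [Set.uIoc_of_le zero_le_one] at ht
      have h1 : (0 : ℝ) ≤ (1 - t) ^ (μ - 1) := Real.rpow_nonneg (by linarith [ht.2]) _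
      rw [norm_mul, norm_mul, Real.norm_of_nonneg h1, norm_pow, Real.norm_of_nonneg ht.1.le]
      exact mul_le_mul_of_nonneg_left
        (mul_le_of_le_one_right (norm_nonneg _) (pow_le_one₀ ht.1.le ht.2)) h1
    · exact Filter.Eventually.of_forall fun t _ => hc.mul_left _
    · simp_rw [tsum_mul_left]
      exact (intervalIntegrable_one_sub_rpow hμ).mul_const _
    · exact Filter.Eventually.of_forall fun t _ => (hf t).mul_left _
  refine key.congr_fun fun n => ?_
  rw [← integral_one_sub_rpow_mul_pow hμ, ← intervalIntegral.integral_const_mul]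
  exact integral_congr fun t _ => by ring

/-- The coefficients of the Lommel series, simplified by the duplication formula. -/
theorem lommel_coeff_eq {μ : ℝ} (hμ : 0 < μ) (n : ℕ) :
    Real.Gamma (μ / 2 + 1) * Real.Gamma (μ / 2 + 3 / 2) /
      (4 ^ n * Real.Gamma (μ / 2 + n + 1) * Real.Gamma (μ / 2 + n + 3 / 2)) =
      Real.Gamma (μ + 2) / Real.Gamma (μ + (2 * n : ℕ) + 2) := by
  have dup (m : ℕ) : 4 ^ m * Real.Gamma (μ / 2 + m + 1) * Real.Gamma (μ / 2 + m + 3 / 2) =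
      Real.Gamma (μ + (2 * m : ℕ) + 2) * ((2 : ℝ) ^ (-1 - μ) * √Real.pi) := by
    have h := Real.Gamma_mul_Gamma_add_half (μ / 2 + m + 1)
    rw [show μ / 2 + m + 1 + 1 / 2 = μ / 2 + m + 3 / 2 by ring,
      show 2 * (μ / 2 + m + 1) = μ + (2 * m : ℕ) + 2 by push_cast; ring,
      show 1 - (μ + (2 * m : ℕ) + 2) = (-1 - μ) - (2 * m : ℕ) by ring,
      Real.rpow_sub_natCast (by norm_num), pow_mul] at h
    rw [mul_assoc, h]
    norm_num
    field_simp
  have h0 := dup 0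
  simp only [pow_zero, one_mul, Nat.cast_zero, add_zero, mul_zero] at h0
  have : (0 : ℝ) < (2 : ℝ) ^ (-1 - μ) * √Real.pi := by positivity
  rw [h0, dup, mul_div_mul_right _ _ this.ne']

/-- `Γ(s + k) ≥ k! Γ(s)` for `s ≥ 1`. -/
theorem factorial_mul_Gamma_le {s : ℝ} (hs : 1 ≤ s) (k : ℕ) :
    (k.factorial : ℝ) * Real.Gamma s ≤ Real.Gamma (s + k) := by
  induction k with
  | zero => simp
  | succ k ih =>
    have hk : (0 : ℝ) < s + k := by positivity
    rw [Nat.factorial_succ, Nat.cast_succ, ← add_assoc, Real.Gamma_add_one hk.ne']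
    push_cast
    rw [mul_assoc]
    have := Real.Gamma_pos_of_pos (zero_lt_one.trans_le hs)
    exact mul_le_mul (by linarith) ih (by positivity) hk.le

theorem summable_pow_div_factorial_comp (x : ℝ) {e : ℕ → ℕ} (he : e.Injective) :
    Summable fun n => x ^ e n / ((e n).factorial : ℝ) :=
  (Real.summable_pow_div_factorial x).comp_injective he

/-- The derivative at `1` of the Lommel function is obtained by termwise differentiation. -/
theorem hasDerivAt_lommelLR_one {μ : ℝ} (hμ : 0 < μ) :
    HasDerivAt (lommelLR μ)
      (∑' n : ℕ, (-1 : ℝ) ^ n * (Real.Gamma (μ + 2) / Real.Gamma (μ + (2 * n : ℕ) + 2)) *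
        (n + 1)) 1 := by
  set a : ℕ → ℝ := fun n => Real.Gamma (μ + 2) / Real.Gamma (μ + (2 * n : ℕ) + 2) with ha
  have hfun : lommelLR μ = fun x => ∑' n : ℕ, (-1 : ℝ) ^ n * a n * x ^ (n + 1) := by
    funext x
    refine tsum_congr fun n => ?_
    simp only [ha, ← lommel_coeff_eq hμ]
    ring
  have ha0 (n : ℕ) : 0 ≤ a n :=
    div_nonneg (Real.Gamma_nonneg_of_nonneg (by positivity))
      (Real.Gamma_nonneg_of_nonneg (by positivity))
  have ha1 (n : ℕ) : a n ≤ 1 / ((2 * n).factorial : ℝ) := by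
    have h := factorial_mul_Gamma_le (s := μ + 2) (by linarith) (2 * n)
    rw [show μ + 2 + ((2 * n : ℕ) : ℝ) = μ + (2 * n : ℕ) + 2 by ring] at h
    rw [ha, div_le_div_iff₀ (Real.Gamma_pos_of_pos (by positivity)) (by positivity)]
    linarith
  have hu : Summable fun n : ℕ => (2 : ℝ) ^ (2 * n) / ((2 * n).factorial : ℝ) :=
    summable_pow_div_factorial_comp 2 (mul_right_injective₀ two_ne_zero)
  rw [hfun]
  have := hasDerivAt_tsum_of_isPreconnected (𝕜 := ℝ) (t := Metric.ball (0 : ℝ) 2) (y₀ := 0) (y := 1)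
    (g := fun n x => (-1 : ℝ) ^ n * a n * x ^ (n + 1))
    (g' := fun n x => (-1 : ℝ) ^ n * a n * ((n + 1) * x ^ n))
    hu Metric.isOpen_ball (convex_ball 0 2).isPreconnected
    (fun n y _ => by simpa using (hasDerivAt_pow (n + 1) y).const_mul ((-1 : ℝ) ^ n * a n))
    (fun n y hy => ?_) (by simp) (by simp [summable_zero]) (by simp)
  · simpa [ha] using this
  · rw [mem_ball_zero_iff] at hy
    have hn : (n : ℝ) + 1 ≤ 2 ^ n := by exact_mod_cast Nat.lt_two_pow_self (n := n)
    have hn' : |(n : ℝ) + 1| = n + 1 := abs_of_pos (by positivity)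
    have hy' : |y| ^ n ≤ 2 ^ n := pow_le_pow_left₀ (abs_nonneg y) hy.le n
    rw [Real.norm_eq_abs, abs_mul, abs_mul, abs_mul, abs_pow, abs_pow, abs_neg, abs_one, one_pow,
      one_mul, abs_of_nonneg (ha0 n), hn', two_mul n, pow_add, ← two_mul, mul_comm,
      ← mul_one_div]
    exact mul_le_mul (mul_le_mul hn hy' (by positivity) (by positivity)) (ha1 n) (ha0 n)
      (by positivity)

/-- For `μ ∈ (0,1)`, `2 l_μ'(1) = μ(μ+1) ∫₀¹ (1 − t)^(μ−1) (cos t + (1 − μ) sin t) dt`, and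
consequently `l_μ'(1) > 0`. -/
theorem lommelL_deriv_one (μ : ℝ) (hμ₀ : 0 < μ) (hμ₁ : μ < 1) :
    2 * deriv (lommelLR μ) 1 =
      μ * (μ + 1) * ∫ t in (0 : ℝ)..1, (1 - t) ^ (μ - 1) * (Real.cos t + (1 - μ) * Real.sin t) ∧
    0 < deriv (lommelLR μ) 1 := by
  have eq : 2 * deriv (lommelLR μ) 1 = μ * (μ + 1) *
      ∫ t in (0 : ℝ)..1, (1 - t) ^ (μ - 1) * (Real.cos t + (1 - μ) * Real.sin t) := by
    have hce := summable_pow_div_factorial_comp 1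
      (e := fun n => 2 * n) (mul_right_injective₀ two_ne_zero)
    have hso := summable_pow_div_factorial_comp 1
      (e := fun n => 2 * n + 1) (fun a b h => by simpa using h)
    have hc : HasSum _ (∫ t in (0 : ℝ)..1, (1 - t) ^ (μ - 1) * Real.cos t) :=
      hasSum_integral_one_sub_rpow_mul hμ₀ (c := fun n => (-1) ^ n / ((2 * n).factorial : ℝ))
        (e := fun n => 2 * n)
        (by simpa [abs_div] using hce)
        (fun t => by simpa only [div_mul_eq_mul_div] using Real.hasSum_cos t)
    have hs : HasSum _ (∫ t in (0 : ℝ)..1, (1 - t) ^ (μ - 1) * Real.sin t) :=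
      hasSum_integral_one_sub_rpow_mul hμ₀ (c := fun n => (-1) ^ n / ((2 * n + 1).factorial : ℝ))
        (e := fun n => 2 * n + 1)
        (by simpa [abs_div] using hso)
        (fun t => by simpa only [div_mul_eq_mul_div] using Real.hasSum_sin t)
    have hw := intervalIntegrable_one_sub_rpow hμ₀
    have hsplit : (∫ t in (0 : ℝ)..1, (1 - t) ^ (μ - 1) * (Real.cos t + (1 - μ) * Real.sin t)) =
        (∫ t in (0 : ℝ)..1, (1 - t) ^ (μ - 1) * Real.cos t) +
          (1 - μ) * ∫ t in (0 : ℝ)..1, (1 - t) ^ (μ - 1) * Real.sin t := by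
      rw [← intervalIntegral.integral_const_mul, ← intervalIntegral.integral_add (hw.mul_continuousOn (by fun_prop))
        ((hw.mul_continuousOn (by fun_prop)).const_mul _)]
      exact integral_congr fun t _ => by ring
    rw [hsplit, ← ((hc.add (hs.mul_left (1 - μ))).mul_left (μ * (μ + 1))).tsum_eq,
      (hasDerivAt_lommelLR_one hμ₀).deriv, ← tsum_mul_left]
    refine tsum_congr fun n => ?_
    have hG : Real.Gamma (μ + 2) = μ * (μ + 1) * Real.Gamma μ := by
      rw [show μ + 2 = μ + 1 + 1 by ring, Real.Gamma_add_one (by positivity),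
        Real.Gamma_add_one hμ₀.ne']
      ring
    have hpos : 0 < μ + (2 * n : ℕ) + 1 := by positivity
    have hΓ := Real.Gamma_pos_of_pos hpos
    rw [show μ + ((2 * n + 1 : ℕ) : ℝ) + 1 = μ + (2 * n : ℕ) + 1 + 1 by push_cast; ring,
      show μ + ((2 * n : ℕ) : ℝ) + 2 = μ + (2 * n : ℕ) + 1 + 1 by ring,
      Real.Gamma_add_one hpos.ne', hG]
    field_simp
    push_cast
    ring
  refine ⟨eq, ?_⟩
  have hint : 0 < ∫ t in (0 : ℝ)..1,
      (1 - t) ^ (μ - 1) * (Real.cos t + (1 - μ) * Real.sin t) := by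
    refine intervalIntegral_pos_of_pos_on
      ((intervalIntegrable_one_sub_rpow hμ₀).mul_continuousOn (by fun_prop)) (fun t ht => ?_)
      zero_lt_one
    have hcos := Real.cos_pos_of_le_one (abs_le.2 ⟨by linarith [ht.1], ht.2.le⟩)
    have hsin := Real.sin_pos_of_pos_of_le_one ht.1 ht.2.le
    have h1 : 0 < 1 - t := by linarith [ht.2]
    have h2 : 0 < 1 - μ := by linarith
    positivity
  have : 0 < 2 * deriv (lommelLR μ) 1 := by rw [eq]; positivity
  linarith
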